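/- Let σ1, σ2 > 0, ρ ∈ (−1,1), α1 ∈ (−1,0) and α2 > 2, and set C := (2^{(α1+α2)/2} α1 α2 σ1^{α1} σ2^{α2} ρ² / (2π)) · Γ((α1+1)/2) · Γ((α2+1)/2) and G := Γ(3/2)·Γ((α1+α2−1)/2) / (Γ((α1+1)/2)·Γ((α2+1)/2)). Then C ≤ E[|X1|^{α1}|X2|^{α2}] − E[|X1|^{α1}]·E[|X2|^{α2}] ≤ min{C·G, 0}. -/

import Mathlib

open MeasureTheory Real

/-- Centered bivariate Gaussian density with variances σ₁², σ₂² and correlation ρ. -/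
noncomputable def gaussDensity2 (σ₁ σ₂ ρ x y : ℝ) : ℝ :=
  (2 * π * σ₁ * σ₂ * Real.sqrt (1 - ρ ^ 2))⁻¹ *
    Real.exp (-(x ^ 2 / σ₁ ^ 2 - 2 * ρ * x * y / (σ₁ * σ₂) + y ^ 2 / σ₂ ^ 2) /
      (2 * (1 - ρ ^ 2)))

/-- E[|X₁|^a |X₂|^b] for the centered bivariate Gaussian. -/
noncomputable def E2 (σ₁ σ₂ ρ a b : ℝ) : ℝ :=
  ∫ q : ℝ × ℝ, |q.1| ^ a * |q.2| ^ b * gaussDensity2 σ₁ σ₂ ρ q.1 q.2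

/-- E[|X|^a] for a centered Gaussian with variance σ². -/
noncomputable def E1 (σ a : ℝ) : ℝ :=
  ∫ x : ℝ, |x| ^ a * (Real.sqrt (2 * π * σ ^ 2))⁻¹ * Real.exp (-x ^ 2 / (2 * σ ^ 2))

/-- The rising factorial `x (x + 1) ⋯ (x + n - 1)`. -/
noncomputable def poch (x : ℝ) (n : ℕ) : ℝ := (ascPochhammer ℝ n).eval x

/-- The `n`-th coefficient of the Gauss hypergeometric series `F(p, q; r; ·)`. -/
noncomputable def hyperCoeff (p q r : ℝ) (n : ℕ) : ℝ :=
  poch p n * poch q n / (poch r n * n.factorial)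

/-- The `n`-th Taylor coefficient of `(1 - t) ^ (-s)`. -/
noncomputable def binomCoeff (s : ℝ) (n : ℕ) : ℝ := poch s n / n.factorial

lemma poch_zero (x : ℝ) : poch x 0 = 1 := by simp [poch]

lemma poch_succ (x : ℝ) (n : ℕ) : poch x (n + 1) = poch x n * (x + n) :=
  ascPochhammer_succ_eval n x

lemma poch_pos {x : ℝ} (hx : 0 < x) (n : ℕ) : 0 < poch x n := ascPochhammer_pos n x hx

lemma Gamma_add_nat {x : ℝ} (hx : 0 < x) (n : ℕ) : Gamma (x + n) = poch x n * Gamma x := by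
  induction n with
  | zero => simp [poch_zero]
  | succ n ih =>
    have hxn : x + n ≠ 0 := by positivity
    rw [poch_succ, Nat.cast_succ, ← add_assoc, Gamma_add_one hxn, ih]
    ring

lemma binomCoeff_zero (s : ℝ) : binomCoeff s 0 = 1 := by simp [binomCoeff, poch_zero]

lemma binomCoeff_succ (s : ℝ) (n : ℕ) :
    (n + 1) * binomCoeff s (n + 1) = (n + s) * binomCoeff s n := by
  unfold binomCoeff
  rw [poch_succ, Nat.factorial_succ]
  push_cast
  field_simp
  ring

lemma binomCoeff_add_one (s : ℝ) (n : ℕ) :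
    s * binomCoeff (s + 1) n = (s + n) * binomCoeff s n := by
  induction n with
  | zero => simp [binomCoeff_zero]
  | succ n ih =>
    have h1 := binomCoeff_succ s n
    have h2 := binomCoeff_succ (s + 1) n
    have hn : (n + 1 : ℝ) ≠ 0 := by positivity
    apply mul_left_cancel₀ hn
    push_cast
    linear_combination s * h2 + (n + (s + 1)) * ih - (s + (n + 1)) * h1

lemma binomCoeff_eq_choose (s : ℝ) (n : ℕ) : binomCoeff s n = Ring.choose (s + n - 1) n := by
  rw [← Ring.multichoose_eq]
  have h := Ring.factorial_nsmul_multichoose_eq_ascPochhammer s n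
  rw [Polynomial.ascPochhammer_smeval_eq_eval, nsmul_eq_mul] at h
  unfold binomCoeff poch
  rw [← h]
  field_simp

lemma hasSum_binomCoeff (s : ℝ) {t : ℝ} (ht : |t| < 1) :
    HasSum (fun n => binomCoeff s n * t ^ n) ((1 - t) ^ (-s)) := by
  have h := (Real.one_div_one_sub_rpow_hasFPowerSeriesOnBall_zero s).hasSum
    (y := t) (by simpa [enorm_eq_nnnorm, ← NNReal.coe_lt_coe] using ht)
  have h1 : 0 ≤ 1 - t := by linarith [(abs_lt.1 ht).2]
  rw [zero_add, one_div, ← rpow_neg h1] at h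
  convert! h using 2 with n
  simp [binomCoeff_eq_choose, mul_comm]

lemma hyperCoeff_zero (p q r : ℝ) : hyperCoeff p q r 0 = 1 := by simp [hyperCoeff, poch_zero]

lemma hyperCoeff_pos {p q r : ℝ} (hp : 0 < p) (hq : 0 < q) (hr : 0 < r) (n : ℕ) :
    0 < hyperCoeff p q r n := by
  have := poch_pos hp n
  have := poch_pos hq n
  have := poch_pos hr n
  unfold hyperCoeff
  positivity

lemma hyperCoeff_succ (p q : ℝ) {r : ℝ} (hr : 0 < r) (n : ℕ) :
    (n + 1) * (r + n) * hyperCoeff p q r (n + 1) = (p + n) * (q + n) * hyperCoeff p q r n := by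
  have := (poch_pos hr n).ne'
  have : r + n ≠ 0 := by positivity
  unfold hyperCoeff
  simp only [poch_succ, Nat.factorial_succ]
  push_cast
  field_simp

lemma hyperCoeff_add_one (p q : ℝ) {r : ℝ} (hr : 0 < r) (n : ℕ) :
    (r + n) * hyperCoeff p q (r + 1) n = r * hyperCoeff p q r n := by
  have hpoch : r * poch (r + 1) n = (r + n) * poch r n := by
    have h := binomCoeff_add_one r n
    unfold binomCoeff at h
    field_simp at h
    exact h
  have := poch_pos hr n
  have := poch_pos (by linarith : 0 < r + 1) n
  unfold hyperCoeff
  field_simp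
  linear_combination -(poch p n * poch q n) * hpoch

/-- Contiguity relation underlying
`d/dt [(1 - t) ^ (p + q - r) F(p, q; r; t)] =
  (r - p) (r - q) / r * (1 - t) ^ (p + q - r - 1) F(p, q; r + 1; t)`. -/
lemma hyperCoeff_contiguous (p q : ℝ) {r : ℝ} (hr : 0 < r) (n : ℕ) :
    (n + 1) * hyperCoeff p q r (n + 1) =
      (n + (p + q - r)) * hyperCoeff p q r n +
        (r - p) * (r - q) / r * hyperCoeff p q (r + 1) n := by
  have h1 := hyperCoeff_succ p q hr n
  have h2 := hyperCoeff_add_one p q hr n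
  have hrn : r + n ≠ 0 := by positivity
  apply mul_left_cancel₀ hrn
  have hκ : (r - p) * (r - q) / r * r = (r - p) * (r - q) := div_mul_cancel₀ _ hr.ne'
  linear_combination h1 - (r - p) * (r - q) / r * h2 - hyperCoeff p q r n * hκ

/-- Log-convexity of `Γ`: spreading two arguments with a fixed sum increases the product. -/
lemma Gamma_mul_Gamma_le {p q r : ℝ} (hp : 0 < p) (hpr : p < r) (hrq : r < q) :
    Gamma r * Gamma (p + q - r) ≤ Gamma p * Gamma q := by
  have hq : 0 < q := by linarith
  have hd : 0 < q - p := by linarith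
  have ha : 0 < (q - r) / (q - p) := div_pos (by linarith) hd
  have hb : 0 < (r - p) / (q - p) := div_pos (by linarith) hd
  have hab : (q - r) / (q - p) + (r - p) / (q - p) = 1 := by field_simp; ring
  have h1 := Gamma_mul_add_mul_le_rpow_Gamma_mul_rpow_Gamma hp hq ha hb hab
  have h2 := Gamma_mul_add_mul_le_rpow_Gamma_mul_rpow_Gamma hq hp ha hb hab
  rw [show (q - r) / (q - p) * p + (r - p) / (q - p) * q = r by field_simp; ring] at h1
  rw [show (q - r) / (q - p) * q + (r - p) / (q - p) * p = p + q - r by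
    field_simp; ring] at h2
  have hGp := Gamma_pos_of_pos hp
  have hGq := Gamma_pos_of_pos hq
  calc Gamma r * Gamma (p + q - r)
      ≤ (Gamma p ^ ((q - r) / (q - p)) * Gamma q ^ ((r - p) / (q - p))) *
        (Gamma q ^ ((q - r) / (q - p)) * Gamma p ^ ((r - p) / (q - p))) :=
        mul_le_mul h1 h2 (Gamma_pos_of_pos (by linarith)).le (by positivity)
    _ = Gamma p ^ ((q - r) / (q - p) + (r - p) / (q - p)) *
        Gamma q ^ ((q - r) / (q - p) + (r - p) / (q - p)) := by
        rw [rpow_add hGp, rpow_add hGq]; ring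
    _ = Gamma p * Gamma q := by rw [hab, rpow_one, rpow_one]

lemma hyperCoeff_le_binomCoeff {p q r : ℝ} (hp : 0 < p) (hpr : p < r) (hrq : r < q) (n : ℕ) :
    hyperCoeff p q r n ≤ binomCoeff (p + q - r) n := by
  have hr : 0 < r := by linarith
  induction n with
  | zero => simp [hyperCoeff_zero, binomCoeff_zero]
  | succ n ih =>
    have h1 := hyperCoeff_succ p q hr n
    have h2 := binomCoeff_succ (p + q - r) n
    have hpos := hyperCoeff_pos hp (by linarith : 0 < q) hr n
    have hn : (0 : ℝ) < (n + 1) * (r + n) := by positivity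
    have hs : 0 < n + (p + q - r) := by
      have : (0 : ℝ) ≤ n := n.cast_nonneg
      linarith
    refine le_of_mul_le_mul_left ?_ hn
    calc (n + 1) * (r + n) * hyperCoeff p q r (n + 1)
        = (p + n) * (q + n) * hyperCoeff p q r n := h1
      _ ≤ (r + n) * (n + (p + q - r)) * hyperCoeff p q r n := by
        refine mul_le_mul_of_nonneg_right ?_ hpos.le
        nlinarith [mul_pos (sub_pos.2 hpr) (sub_pos.2 hrq)]
      _ ≤ (r + n) * (n + (p + q - r)) * binomCoeff (p + q - r) n := by gcongr
      _ = (n + 1) * (r + n) * binomCoeff (p + q - r) (n + 1) := by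
        linear_combination -(r + n) * h2

lemma le_hyperCoeff {p q r : ℝ} (hp : 0 < p) (hpr : p < r) (hrq : r < q) (n : ℕ) :
    Gamma r * Gamma (p + q - r) / (Gamma p * Gamma q) * binomCoeff (p + q - r) n ≤
      hyperCoeff p q r n := by
  have hr : 0 < r := by linarith
  have hq : 0 < q := by linarith
  have hs : 0 < p + q - r := by linarith
  have hn : (0 : ℝ) ≤ n := n.cast_nonneg
  have h := Gamma_mul_Gamma_le (p := p + n) (q := q + n) (r := r + n)
    (by linarith) (by linarith) (by linarith)
  rw [show p + n + (q + n) - (r + n) = p + q - r + n by ring, Gamma_add_nat hp, Gamma_add_nat hq,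
    Gamma_add_nat hr, Gamma_add_nat hs] at h
  have := Gamma_pos_of_pos hp
  have := Gamma_pos_of_pos hq
  have := poch_pos hr n
  unfold hyperCoeff binomCoeff
  rw [div_mul_div_comm, div_le_div_iff₀ (by positivity) (by positivity)]
  have hf : (0 : ℝ) < n.factorial := by positivity
  nlinarith [mul_le_mul_of_nonneg_left h hf.le]

/-- Coefficientwise comparison of `F(p, q; r; t)` with `(1 + κ t) (1 - t) ^ (r - p - q)`. -/
lemma hyperCoeff_bounds {p q r : ℝ} (hp : 0 < p) (hpr : p < r) (hrq : r + 1 < q) (n : ℕ) :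
    binomCoeff (p + q - r) (n + 1) + (r - p) * (r - q) / r * binomCoeff (p + q - r) n ≤
        hyperCoeff p q r (n + 1) ∧
      hyperCoeff p q r (n + 1) ≤ binomCoeff (p + q - r) (n + 1) + (r - p) * (r - q) / r *
        (Gamma (r + 1) * Gamma (p + q - (r + 1)) / (Gamma p * Gamma q)) *
          binomCoeff (p + q - r) n := by
  have hr : 0 < r := by linarith
  set κ := (r - p) * (r - q) / r with hκ
  have hκ0 : κ ≤ 0 := div_nonpos_of_nonpos_of_nonneg
    (mul_nonpos_of_nonneg_of_nonpos (by linarith) (by linarith)) hr.le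
  set G := Gamma (r + 1) * Gamma (p + q - (r + 1)) / (Gamma p * Gamma q) with hG
  obtain ⟨s, hs⟩ : ∃ s, s = p + q - (r + 1) := ⟨_, rfl⟩
  have hs1 : p + q - r = s + 1 := by rw [hs]; ring
  have hs0 : 0 < s := by linarith
  have hub (n : ℕ) : κ * hyperCoeff p q (r + 1) n ≤ κ * (G * binomCoeff s n) := by
    refine mul_le_mul_of_nonpos_left ?_ hκ0
    rw [hs]
    exact le_hyperCoeff hp (by linarith) hrq n
  have hlb (n : ℕ) : κ * binomCoeff s n ≤ κ * hyperCoeff p q (r + 1) n := by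
    refine mul_le_mul_of_nonpos_left ?_ hκ0
    rw [hs]
    exact hyperCoeff_le_binomCoeff hp (by linarith) hrq n
  have hcont (n : ℕ) := hyperCoeff_contiguous p q hr n
  simp only [← hκ, hs1] at hcont
  rw [hs1]
  have hbin (n : ℕ) : (n + 2) * binomCoeff (s + 1) (n + 1) =
      (n + 1 + (s + 1)) * binomCoeff (s + 1) n + binomCoeff s (n + 1) := by
    have h1 := binomCoeff_succ (s + 1) n
    have h2 := binomCoeff_add_one s (n + 1)
    push_cast at h2
    have hne : s + (n + 1) ≠ 0 := by positivity
    apply mul_left_cancel₀ hne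
    linear_combination (n + 1 + (s + 1)) * h1 + h2
  induction n with
  | zero =>
    have h1 := hcont 0
    have h2 := binomCoeff_succ (s + 1) 0
    have h3 := hub 0
    have h4 := hlb 0
    simp only [hyperCoeff_zero, binomCoeff_zero, Nat.cast_zero] at *
    constructor <;> linarith
  | succ n ih =>
    obtain ⟨ih1, ih2⟩ := ih
    have h1 := hcont (n + 1)
    have h2 := binomCoeff_succ (s + 1) (n + 1)
    have h3 := hub (n + 1)
    have h4 := hlb (n + 1)
    have h5 := hbin n
    push_cast at h1 h2
    have hc : (0 : ℝ) ≤ n + 1 + (s + 1) := by positivity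
    have hn : (0 : ℝ) < n + 1 + 1 := by positivity
    have ih1' := mul_le_mul_of_nonneg_left ih1 hc
    have ih2' := mul_le_mul_of_nonneg_left ih2 hc
    constructor
    · refine le_of_mul_le_mul_left ?_ hn
      rw [h1]
      linear_combination ih1' + h4 + h2 + κ * h5
    · refine le_of_mul_le_mul_left ?_ hn
      rw [h1]
      linear_combination ih2' + h3 - h2 - κ * G * h5

/-- Bounds for the sum of `F(p, q; r; t)`. -/
lemma hyper_bounds {p q r t : ℝ} (hp : 0 < p) (hpr : p < r) (hrq : r + 1 < q)
    (ht0 : 0 ≤ t) (ht1 : t < 1) :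
    Summable (fun n => hyperCoeff p q r n * t ^ n) ∧
    (1 + (r - p) * (r - q) / r * t) * (1 - t) ^ (-(p + q - r)) ≤
      ∑' n, hyperCoeff p q r n * t ^ n ∧
    ∑' n, hyperCoeff p q r n * t ^ n ≤ (1 + (r - p) * (r - q) / r *
      (Gamma (r + 1) * Gamma (p + q - (r + 1)) / (Gamma p * Gamma q)) * t) *
        (1 - t) ^ (-(p + q - r)) := by
  have hr : 0 < r := by linarith
  have hb := hasSum_binomCoeff (p + q - r) (t := t) (by rwa [abs_of_nonneg ht0])
  have hbound (c : ℝ) : HasSum (fun n => (binomCoeff (p + q - r) (n + 1) +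
      c * binomCoeff (p + q - r) n) * t ^ (n + 1))
      ((1 + c * t) * (1 - t) ^ (-(p + q - r)) - 1) := by
    have h1 := (hasSum_nat_add_iff' 1).2 hb
    convert! h1.add (hb.mul_left (c * t)) using 1
    · ext n; ring
    · simp [binomCoeff_zero]; ring
  have hpow (n : ℕ) : 0 ≤ t ^ (n + 1) := by positivity
  have hsum : Summable (fun n => hyperCoeff p q r (n + 1) * t ^ (n + 1)) :=
    Summable.of_nonneg_of_le
      (fun n => mul_nonneg (hyperCoeff_pos hp (by linarith) hr _).le (hpow n))
      (fun n => mul_le_mul_of_nonneg_right (hyperCoeff_bounds hp hpr hrq n).2 (hpow n))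
      (hbound _).summable
  have hsum' := (summable_nat_add_iff (f := fun n => hyperCoeff p q r n * t ^ n) 1).1 hsum
  have h0 := hsum'.tsum_eq_zero_add
  simp only [hyperCoeff_zero, pow_zero, mul_one] at h0
  have hl := hasSum_le (fun n => mul_le_mul_of_nonneg_right (hyperCoeff_bounds hp hpr hrq n).1
    (hpow n)) (hbound _) hsum.hasSum
  have hu := hasSum_le (fun n => mul_le_mul_of_nonneg_right (hyperCoeff_bounds hp hpr hrq n).2
    (hpow n)) hsum.hasSum (hbound _)
  refine ⟨hsum', ?_, ?_⟩ <;> linarith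

lemma integral_abs_rpow_mul_exp {a A : ℝ} (ha : -1 < a) (hA : 0 < A) :
    ∫ x : ℝ, |x| ^ a * exp (-A * x ^ 2) = A ^ (-((a + 1) / 2)) * Gamma ((a + 1) / 2) := by
  have h := integral_comp_abs (f := fun x => x ^ a * exp (-A * x ^ (2 : ℝ)))
  rw [integral_rpow_mul_exp_neg_mul_rpow two_pos ha hA] at h
  simp only [rpow_two, sq_abs] at h
  rw [h, neg_div]
  ring

lemma integrable_abs_rpow_mul_exp {a A : ℝ} (ha : -1 < a) (hA : 0 < A) :
    Integrable fun x : ℝ => |x| ^ a * exp (-A * x ^ 2) := by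
  refine Integrable.of_integral_ne_zero ?_
  rw [integral_abs_rpow_mul_exp ha hA]
  have := Gamma_pos_of_pos (by linarith : 0 < (a + 1) / 2)
  positivity

lemma abs_rpow_mul_pow_ae (a : ℝ) (n : ℕ) :
    ∀ᵐ x : ℝ, |x| ^ a * x ^ (2 * n) = |x| ^ (a + 2 * n) := by
  filter_upwards [Measure.ae_ne volume (0 : ℝ)] with x hx
  rw [rpow_add (abs_pos.2 hx), ← (even_two_mul n).pow_abs]
  norm_cast

lemma integral_abs_rpow_mul_pow_mul_exp {a A : ℝ} (ha : -1 < a) (hA : 0 < A) (n : ℕ) :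
    Integrable (fun x : ℝ => |x| ^ a * exp (-A * x ^ 2) * x ^ (2 * n)) ∧
    ∫ x : ℝ, |x| ^ a * exp (-A * x ^ 2) * x ^ (2 * n) =
      A ^ (-((a + 1) / 2)) * (A ^ n)⁻¹ * Gamma ((a + 1) / 2 + n) := by
  have hae : (fun x : ℝ => |x| ^ a * exp (-A * x ^ 2) * x ^ (2 * n)) =ᵐ[volume]
      fun x => |x| ^ (a + 2 * n) * exp (-A * x ^ 2) := by
    filter_upwards [abs_rpow_mul_pow_ae a n] with x hx
    rw [← hx]
    ring
  have han : -1 < a + 2 * n := by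
    have : (0 : ℝ) ≤ n := n.cast_nonneg
    linarith
  refine ⟨(integrable_abs_rpow_mul_exp han hA).congr hae.symm, ?_⟩
  rw [integral_congr_ae hae, integral_abs_rpow_mul_exp han hA,
    show (a + 2 * n + 1) / 2 = (a + 1) / 2 + n by ring, neg_add, rpow_add hA, rpow_neg hA.le n,
    rpow_natCast]

/-- Term-by-term evaluation of a bivariate Gaussian absolute moment. -/
lemma hasSum_integral_gaussian {a b A B c : ℝ} (ha : -1 < a) (hb : -1 < b)
    (hA : 0 < A) (hB : 0 < B)
    (hsum : Summable fun n : ℕ => c ^ (2 * n) / (2 * n).factorial *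
      ((A ^ (-((a + 1) / 2)) * (A ^ n)⁻¹ * Gamma ((a + 1) / 2 + n)) *
        (B ^ (-((b + 1) / 2)) * (B ^ n)⁻¹ * Gamma ((b + 1) / 2 + n)))) :
    HasSum (fun n : ℕ => c ^ (2 * n) / (2 * n).factorial *
      ((A ^ (-((a + 1) / 2)) * (A ^ n)⁻¹ * Gamma ((a + 1) / 2 + n)) *
        (B ^ (-((b + 1) / 2)) * (B ^ n)⁻¹ * Gamma ((b + 1) / 2 + n))))
      (∫ z : ℝ × ℝ, |z.1| ^ a * exp (-A * z.1 ^ 2) * (|z.2| ^ b * exp (-B * z.2 ^ 2)) *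
        exp (c * z.1 * z.2)) := by
  set f : ℝ × ℝ → ℝ := fun z =>
    |z.1| ^ a * exp (-A * z.1 ^ 2) * (|z.2| ^ b * exp (-B * z.2 ^ 2)) with hf
  have hf0 (z) : 0 ≤ f z := by simp only [hf]; positivity
  set T : ℕ → ℝ := fun n => c ^ (2 * n) / (2 * n).factorial *
      ((A ^ (-((a + 1) / 2)) * (A ^ n)⁻¹ * Gamma ((a + 1) / 2 + n)) *
        (B ^ (-((b + 1) / 2)) * (B ^ n)⁻¹ * Gamma ((b + 1) / 2 + n))) with hT
  let F : ℕ → ℝ × ℝ → ℝ := fun n z => c ^ (2 * n) / (2 * n).factorial *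
    ((|z.1| ^ a * exp (-A * z.1 ^ 2) * z.1 ^ (2 * n)) *
      (|z.2| ^ b * exp (-B * z.2 ^ 2) * z.2 ^ (2 * n)))
  have hFf (n z) : F n z = f z * ((c * z.1 * z.2) ^ (2 * n) / (2 * n).factorial) := by
    simp only [F, hf]; ring
  have hF0 (n z) : 0 ≤ F n z := by
    rw [hFf]
    have := (even_two_mul n).pow_nonneg (c * z.1 * z.2)
    have := hf0 z
    positivity
  have hFint (n) : Integrable (F n) :=
    ((integral_abs_rpow_mul_pow_mul_exp ha hA n).1.mul_prod
      (integral_abs_rpow_mul_pow_mul_exp hb hB n).1).const_mul _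
  have hFval (n) : ∫ z, F n z = T n := by
    simp only [F, hT]
    rw [integral_const_mul, Measure.volume_eq_prod, integral_prod_mul
      (fun x : ℝ => |x| ^ a * exp (-A * x ^ 2) * x ^ (2 * n))
      (fun y : ℝ => |y| ^ b * exp (-B * y ^ 2) * y ^ (2 * n)),
      (integral_abs_rpow_mul_pow_mul_exp ha hA n).2,
      (integral_abs_rpow_mul_pow_mul_exp hb hB n).2]
  have hnorm : Summable fun n => ∫ z, ‖F n z‖ := by
    simpa only [norm_of_nonneg (hF0 _ _), hFval] using hsum
  have hmain := hasSum_integral_of_summable_integral_norm hFint hnorm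
  simp only [hFval] at hmain
  have htsum (z) : ∑' n, F n z = f z * cosh (c * z.1 * z.2) := by
    simp only [hFf]
    exact ((hasSum_cosh _).mul_left _).tsum_eq
  simp only [htsum] at hmain
  have hTpos (n) : 0 ≤ T n := by rw [← hFval]; exact integral_nonneg (hF0 n)
  have hT0 : 0 < T 0 := by
    have := Gamma_pos_of_pos (by linarith : 0 < (a + 1) / 2)
    have := Gamma_pos_of_pos (by linarith : 0 < (b + 1) / 2)
    simp only [hT, mul_zero, pow_zero, Nat.cast_zero, add_zero]
    positivity
  have hcosh : Integrable fun z => f z * cosh (c * z.1 * z.2) := by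
    refine Integrable.of_integral_ne_zero (ne_of_gt ?_)
    exact hT0.trans_le (le_hasSum hmain 0 fun n _ => hTpos n)
  have hfm : Measurable f := by simp only [hf]; fun_prop
  have hsinh : Integrable fun z => f z * sinh (c * z.1 * z.2) := by
    refine hcosh.mono (by fun_prop) (ae_of_all _ fun z => ?_)
    rw [norm_mul (f z), norm_mul (f z)]
    refine mul_le_mul_of_nonneg_left ?_ (norm_nonneg _)
    rw [Real.norm_eq_abs, Real.norm_eq_abs, abs_sinh, abs_of_pos (cosh_pos _), ← cosh_abs (c * z.1 * z.2)]
    exact (sinh_lt_cosh _).le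
  have hodd : ∫ z, f z * sinh (c * z.1 * z.2) = 0 := by
    have hmp : MeasurePreserving (Prod.map id (fun y : ℝ => -y) : ℝ × ℝ → ℝ × ℝ) volume volume :=
      (MeasurePreserving.id volume).prod (Measure.measurePreserving_neg volume)
    have hemb : MeasurableEmbedding (Prod.map id (fun y : ℝ => -y) : ℝ × ℝ → ℝ × ℝ) :=
      ((MeasurableEquiv.refl ℝ).prodCongr (MeasurableEquiv.neg ℝ)).measurableEmbedding
    have h := hmp.integral_comp hemb (fun z => f z * sinh (c * z.1 * z.2))
    simp only [hf, Prod.map_fst, Prod.map_snd, id_eq, abs_neg, neg_sq, mul_neg, sinh_neg,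
      integral_neg] at h
    simp only [hf]
    linarith
  convert! hmain using 1
  have hsplit : (fun z : ℝ × ℝ => f z * exp (c * z.1 * z.2)) =
      fun z => f z * cosh (c * z.1 * z.2) + f z * sinh (c * z.1 * z.2) := by
    ext z; rw [← mul_add, cosh_add_sinh]
  rw [hsplit, integral_add hcosh hsinh, hodd, add_zero]

lemma factorial_two_mul (n : ℕ) :
    ((2 * n).factorial : ℝ) = 4 ^ n * (poch (1 / 2) n * n.factorial) := by
  induction n with
  | zero => simp [poch_zero]
  | succ n ih =>
    rw [show 2 * (n + 1) = 2 * n + 1 + 1 by ring, Nat.factorial_succ, Nat.factorial_succ,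
      Nat.factorial_succ, poch_succ]
    push_cast
    rw [ih]
    ring

lemma inv_two_mul_sq_rpow {σ u : ℝ} (hσ : 0 < σ) (hu : 0 < u) (a : ℝ) :
    ((2 * σ ^ 2 * u)⁻¹) ^ (-((a + 1) / 2)) =
      √2 * 2 ^ (a / 2) * σ ^ a * σ * u ^ ((a + 1) / 2) := by
  rw [inv_rpow (by positivity), rpow_neg (by positivity), inv_inv,
    mul_rpow (by positivity) hu.le, mul_rpow two_pos.le (by positivity), ← rpow_two,
    ← rpow_mul hσ.le, show 2 * ((a + 1) / 2) = a + 1 by ring, rpow_add_one hσ.ne',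
    show (a + 1) / 2 = 1 / 2 + a / 2 by ring, rpow_add two_pos, sqrt_eq_rpow]
  ring

lemma E1_eq {σ a : ℝ} (hσ : 0 < σ) (ha : -1 < a) :
    E1 σ a = 2 ^ (a / 2) * σ ^ a * Gamma ((a + 1) / 2) / √π := by
  have hA : 0 < (2 * σ ^ 2 * 1)⁻¹ := by positivity
  have hfun : (fun x : ℝ => |x| ^ a * (√(2 * π * σ ^ 2))⁻¹ * exp (-x ^ 2 / (2 * σ ^ 2))) =
      fun x => (√(2 * π * σ ^ 2))⁻¹ * (|x| ^ a * exp (-(2 * σ ^ 2 * 1)⁻¹ * x ^ 2)) := by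
    ext x
    rw [show -x ^ 2 / (2 * σ ^ 2) = -(2 * σ ^ 2 * 1)⁻¹ * x ^ 2 by field_simp]
    ring
  rw [E1, hfun, integral_const_mul, integral_abs_rpow_mul_exp ha hA,
    inv_two_mul_sq_rpow hσ one_pos, one_rpow, sqrt_mul (by positivity),
    sqrt_mul (by positivity), sqrt_sq hσ.le]
  field_simp

/-- Euler-transformed hypergeometric representation of the mixed absolute moment. -/
lemma E2_eq {σ₁ σ₂ ρ a b : ℝ} (hσ₁ : 0 < σ₁) (hσ₂ : 0 < σ₂) (hρ : ρ ^ 2 < 1)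
    (ha : -1 < a) (hb : -1 < b)
    (hsum : Summable fun n => hyperCoeff ((a + 1) / 2) ((b + 1) / 2) (1 / 2) n * (ρ ^ 2) ^ n) :
    E2 σ₁ σ₂ ρ a b = E1 σ₁ a * E1 σ₂ b *
      (1 - ρ ^ 2) ^ ((a + 1) / 2 + (b + 1) / 2 - 1 / 2) *
        ∑' n, hyperCoeff ((a + 1) / 2) ((b + 1) / 2) (1 / 2) n * (ρ ^ 2) ^ n := by
  obtain ⟨u, hu⟩ : ∃ u, u = 1 - ρ ^ 2 := ⟨_, rfl⟩
  have hu0 : 0 < u := by linarith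
  set A := (2 * σ₁ ^ 2 * u)⁻¹ with hA
  set B := (2 * σ₂ ^ 2 * u)⁻¹ with hB
  set c := ρ / (σ₁ * σ₂ * u) with hc
  have hA0 : 0 < A := by positivity
  have hB0 : 0 < B := by positivity
  have hcAB : c ^ 2 * A⁻¹ * B⁻¹ = 4 * ρ ^ 2 := by
    rw [hA, hB, hc]
    field_simp
    norm_num
  have hterm (n : ℕ) : c ^ (2 * n) / (2 * n).factorial *
      ((A ^ (-((a + 1) / 2)) * (A ^ n)⁻¹ * Gamma ((a + 1) / 2 + n)) *
        (B ^ (-((b + 1) / 2)) * (B ^ n)⁻¹ * Gamma ((b + 1) / 2 + n))) =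
      A ^ (-((a + 1) / 2)) * Gamma ((a + 1) / 2) *
        (B ^ (-((b + 1) / 2)) * Gamma ((b + 1) / 2)) *
        (hyperCoeff ((a + 1) / 2) ((b + 1) / 2) (1 / 2) n * (ρ ^ 2) ^ n) := by
    have hpow : c ^ (2 * n) * (A ^ n)⁻¹ * (B ^ n)⁻¹ = 4 ^ n * (ρ ^ 2) ^ n := by
      rw [pow_mul, ← inv_pow, ← inv_pow, ← mul_pow, ← mul_pow, hcAB, mul_pow]
    have := poch_pos (by norm_num : (0 : ℝ) < 1 / 2) n
    rw [Gamma_add_nat (by linarith), Gamma_add_nat (by linarith), factorial_two_mul]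
    unfold hyperCoeff
    calc _ = (c ^ (2 * n) * (A ^ n)⁻¹ * (B ^ n)⁻¹) / (4 ^ n * (poch (1 / 2) n * n.factorial)) *
          (A ^ (-((a + 1) / 2)) * B ^ (-((b + 1) / 2)) * (poch ((a + 1) / 2) n *
            Gamma ((a + 1) / 2)) * (poch ((b + 1) / 2) n * Gamma ((b + 1) / 2))) := by ring
      _ = _ := by
        rw [hpow, mul_div_mul_left _ _ (by positivity : (4 : ℝ) ^ n ≠ 0)]
        ring
  have hS := hasSum_integral_gaussian (c := c) ha hb hA0 hB0
    ((summable_congr hterm).2 (hsum.mul_left _))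
  simp only [hterm] at hS
  have hint := hS.unique (hsum.hasSum.mul_left _)
  have hfun : (fun z : ℝ × ℝ => |z.1| ^ a * |z.2| ^ b * gaussDensity2 σ₁ σ₂ ρ z.1 z.2) =
      fun z => (2 * π * σ₁ * σ₂ * √u)⁻¹ * (|z.1| ^ a * exp (-A * z.1 ^ 2) *
        (|z.2| ^ b * exp (-B * z.2 ^ 2)) * exp (c * z.1 * z.2)) := by
    ext z
    rw [gaussDensity2, ← hu, show -(z.1 ^ 2 / σ₁ ^ 2 - 2 * ρ * z.1 * z.2 / (σ₁ * σ₂) +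
      z.2 ^ 2 / σ₂ ^ 2) / (2 * u) = -A * z.1 ^ 2 + -B * z.2 ^ 2 + c * z.1 * z.2 by
        rw [hA, hB, hc]; field_simp; ring, exp_add, exp_add]
    ring
  rw [E2, hfun, integral_const_mul, hint, hA, hB, inv_two_mul_sq_rpow hσ₁ hu0,
    inv_two_mul_sq_rpow hσ₂ hu0, E1_eq hσ₁ ha, E1_eq hσ₂ hb, ← hu, rpow_sub hu0, rpow_add hu0,
    ← sqrt_eq_rpow]
  generalize ∑' n, hyperCoeff ((a + 1) / 2) ((b + 1) / 2) (1 / 2) n * (ρ ^ 2) ^ n = S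
  have h2' : √(2 : ℝ) ^ 2 = 2 := sq_sqrt two_pos.le
  have hπ' : √π ^ 2 = π := sq_sqrt pi_pos.le
  field_simp
  rw [h2', hπ']
  field_simp

theorem opposite_gpi_quantitative_large (σ₁ σ₂ ρ α₁ α₂ : ℝ)
    (hσ₁ : 0 < σ₁) (hσ₂ : 0 < σ₂) (hρ : ρ ∈ Set.Ioo (-1 : ℝ) 1)
    (hα₁ : α₁ ∈ Set.Ioo (-1 : ℝ) 0) (hα₂ : 2 < α₂) :
    2 ^ ((α₁ + α₂) / 2) * α₁ * α₂ * σ₁ ^ α₁ * σ₂ ^ α₂ * ρ ^ 2 / (2 * π) *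
        Real.Gamma ((α₁ + 1) / 2) * Real.Gamma ((α₂ + 1) / 2) ≤
      E2 σ₁ σ₂ ρ α₁ α₂ - E1 σ₁ α₁ * E1 σ₂ α₂ ∧
    E2 σ₁ σ₂ ρ α₁ α₂ - E1 σ₁ α₁ * E1 σ₂ α₂ ≤
      min (2 ^ ((α₁ + α₂) / 2) * α₁ * α₂ * σ₁ ^ α₁ * σ₂ ^ α₂ * ρ ^ 2 / (2 * π) *
            Real.Gamma ((α₁ + 1) / 2) * Real.Gamma ((α₂ + 1) / 2) *
            (Real.Gamma (3 / 2) * Real.Gamma ((α₁ + α₂ - 1) / 2) /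
              (Real.Gamma ((α₁ + 1) / 2) * Real.Gamma ((α₂ + 1) / 2)))) 0 := by
  obtain ⟨hα₁l, hα₁u⟩ := hα₁
  have hρ2 : ρ ^ 2 < 1 := by nlinarith [hρ.1, hρ.2]
  have hu : 0 < 1 - ρ ^ 2 := by linarith
  obtain ⟨hsum, hl, hr⟩ := hyper_bounds (p := (α₁ + 1) / 2) (q := (α₂ + 1) / 2) (r := 1 / 2)
    (by linarith) (by linarith) (by linarith) (sq_nonneg ρ) hρ2
  have hE2 := E2_eq hσ₁ hσ₂ hρ2 hα₁l (by linarith : -1 < α₂) hsum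
  rw [show ((1 : ℝ) / 2 - (α₁ + 1) / 2) * (1 / 2 - (α₂ + 1) / 2) / (1 / 2) = α₁ * α₂ / 2 by
    ring] at hl hr
  rw [show (1 : ℝ) / 2 + 1 = 3 / 2 by norm_num, show (α₁ + 1) / 2 + (α₂ + 1) / 2 - 3 / 2 =
    (α₁ + α₂ - 1) / 2 by ring] at hr
  have hΓ₁ := Gamma_pos_of_pos (by linarith : 0 < (α₁ + 1) / 2)
  have hΓ₂ := Gamma_pos_of_pos (by linarith : 0 < (α₂ + 1) / 2)
  have hΓ₃ := Gamma_pos_of_pos (by linarith : 0 < (α₁ + α₂ - 1) / 2)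
  have hΓ₄ := Gamma_pos_of_pos (by norm_num : (0 : ℝ) < 3 / 2)
  set G := Gamma (3 / 2) * Gamma ((α₁ + α₂ - 1) / 2) /
    (Gamma ((α₁ + 1) / 2) * Gamma ((α₂ + 1) / 2)) with hG
  have hG0 : 0 < G := by positivity
  have hM : E1 σ₁ α₁ * E1 σ₂ α₂ = 2 ^ ((α₁ + α₂) / 2) * σ₁ ^ α₁ * σ₂ ^ α₂ / π *
      Gamma ((α₁ + 1) / 2) * Gamma ((α₂ + 1) / 2) := by
    have hπ' : √π ^ 2 = π := sq_sqrt pi_pos.le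
    rw [E1_eq hσ₁ hα₁l, E1_eq hσ₂ (by linarith), add_div α₁ α₂, rpow_add two_pos]
    field_simp
    rw [hπ']
  have hM0 : 0 < E1 σ₁ α₁ * E1 σ₂ α₂ := by rw [hM]; positivity
  have hC : 2 ^ ((α₁ + α₂) / 2) * α₁ * α₂ * σ₁ ^ α₁ * σ₂ ^ α₂ * ρ ^ 2 / (2 * π) *
      Gamma ((α₁ + 1) / 2) * Gamma ((α₂ + 1) / 2) =
      E1 σ₁ α₁ * E1 σ₂ α₂ * (α₁ * α₂ / 2 * ρ ^ 2) := by
    rw [hM]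
    field_simp
  rw [hC, hE2]
  generalize E1 σ₁ α₁ * E1 σ₂ α₂ = M at *
  generalize ∑' n, hyperCoeff ((α₁ + 1) / 2) ((α₂ + 1) / 2) (1 / 2) n * (ρ ^ 2) ^ n = S at *
  generalize (α₁ + 1) / 2 + (α₂ + 1) / 2 - 1 / 2 = e at *
  have hue : 0 < (1 - ρ ^ 2) ^ e := rpow_pos_of_pos hu e
  rw [rpow_neg hu.le, ← div_eq_mul_inv] at hl hr
  rw [div_le_iff₀ hue] at hl
  rw [le_div_iff₀ hue] at hr
  have hl' := mul_le_mul_of_nonneg_left hl hM0.le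
  have hr' := mul_le_mul_of_nonneg_left hr hM0.le
  have hneg : M * (α₁ * α₂ / 2 * ρ ^ 2) * G ≤ 0 := by
    have : α₁ * α₂ < 0 := mul_neg_of_neg_of_pos hα₁u (by linarith)
    refine mul_nonpos_of_nonpos_of_nonneg (mul_nonpos_of_nonneg_of_nonpos hM0.le ?_) hG0.le
    exact mul_nonpos_of_nonpos_of_nonneg (by linarith) (sq_nonneg ρ)
  rw [min_eq_left hneg]
  constructor
  · linear_combination hl'
  · linear_combination hr'
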